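/- Let P₀ and P₁ be probability measures on a measurable space X with P₁ ≪ P₀ and L = dP₁/dP₀, and let 0 ≤ c₁ ≤ 1 ≤ c₂ < ∞ with c₁ < c₂. Suppose λ* > 0 satisfies E_{P₀}[ min(c₂, max(c₁, L/λ*)) ] = 1, and set E* = min(c₂, max(c₁, L/λ*)). Then for every measurable E : X → ℝ with c₁ ≤ E ≤ c₂ P₀-a.s. and E_{P₀}[E] ≤ 1, one has E_{P₁}[log E] ≤ E_{P₁}[log E*] (expectations in the extended reals, with log 0 = −∞). Moreover, if additionally L > 0 P₀-a.s., the maximizer is unique P₀-almost surely: any such E attaining the maximum equals E* P₀-a.s. -/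

import Mathlib

open MeasureTheory Real Set
open scoped ENNReal

noncomputable section

attribute [local instance] Classical.propDecidable

/-- Nonnegative part of an extended real, as an extended nonnegative real. -/
def eToENN (x : EReal) : ℝ≥0∞ := if x = ⊤ then ⊤ else ENNReal.ofReal x.toReal

/-- Integral of an extended-real-valued function, with values in the extended reals. -/
def eintE {Y : Type*} [MeasurableSpace Y] (μ : Measure Y) (f : Y → EReal) : EReal :=
  ((∫⁻ y, eToENN (f y) ∂μ : ℝ≥0∞) : EReal) - ((∫⁻ y, eToENN (-(f y)) ∂μ : ℝ≥0∞) : EReal)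

/-- Extended-real logarithm, with `log x = -∞` for `x ≤ 0`. -/
def elog (x : ℝ) : EReal := if x ≤ 0 then ⊥ else ((Real.log x : ℝ) : EReal)

lemma elog_of_pos {x : ℝ} (hx : 0 < x) : elog x = (Real.log x : ℝ) := by
  simp [elog, hx.not_ge]

lemma eToENN_coe (x : ℝ) : eToENN (x : EReal) = ENNReal.ofReal x := by
  simp [eToENN]

lemma eToENN_neg_elog (x : ℝ) :
    eToENN (-elog x) = if x ≤ 0 then ⊤ else ENNReal.ofReal (-Real.log x) := by
  split_ifs with h
  · simp [elog, h, eToENN]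
  · rw [elog_of_pos (not_le.1 h), ← EReal.coe_neg, eToENN_coe]

lemma eintE_elog_of_integrable {Y : Type*} [MeasurableSpace Y] {μ : Measure Y} {f : Y → ℝ}
    (hpos : ∀ᵐ y ∂μ, 0 < f y) (hint : Integrable (fun y => Real.log (f y)) μ) :
    eintE μ (fun y => elog (f y)) = ((∫ y, Real.log (f y) ∂μ : ℝ) : EReal) := by
  have h₁ : ∫⁻ y, eToENN (elog (f y)) ∂μ = ∫⁻ y, ENNReal.ofReal (Real.log (f y)) ∂μ := by
    refine lintegral_congr_ae ?_
    filter_upwards [hpos] with y hy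
    rw [elog_of_pos hy, eToENN_coe]
  have h₂ : ∫⁻ y, eToENN (-elog (f y)) ∂μ = ∫⁻ y, ENNReal.ofReal (-Real.log (f y)) ∂μ := by
    refine lintegral_congr_ae ?_
    filter_upwards [hpos] with y hy
    rw [eToENN_neg_elog, if_neg hy.not_ge]
  have e₁ : ∫⁻ y, ENNReal.ofReal (Real.log (f y)) ∂μ ≠ ⊤ := hint.lintegral_lt_top.ne
  have e₂ : ∫⁻ y, ENNReal.ofReal (-Real.log (f y)) ∂μ ≠ ⊤ := hint.neg.lintegral_lt_top.ne
  rw [eintE, h₁, h₂, integral_eq_lintegral_pos_part_sub_lintegral_neg_part hint, EReal.coe_sub,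
    EReal.coe_ennreal_toReal e₁, EReal.coe_ennreal_toReal e₂]

/-- The extended expectation of the logarithm of a function that is bounded above is `-∞`, unless
the function is positive with integrable logarithm. -/
lemma eintE_elog_eq_bot {Y : Type*} [MeasurableSpace Y] {μ : Measure Y} [IsFiniteMeasure μ]
    {f : Y → ℝ} {c : ℝ} (hf : Measurable f) (hfc : ∀ᵐ y ∂μ, f y ≤ c)
    (hnot : ¬ ((∀ᵐ y ∂μ, 0 < f y) ∧ Integrable (fun y => Real.log (f y)) μ)) :
    eintE μ (fun y => elog (f y)) = ⊥ := by
  have htop : ∫⁻ y, eToENN (-elog (f y)) ∂μ = ⊤ := by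
    by_contra hne
    have hmeas : Measurable fun y => eToENN (-elog (f y)) := by
      simp only [eToENN_neg_elog]
      exact Measurable.ite (measurableSet_le hf measurable_const) measurable_const
        (hf.log.neg.ennreal_ofReal)
    have hpos : ∀ᵐ y ∂μ, 0 < f y := by
      filter_upwards [ae_lt_top hmeas hne] with y hy
      by_contra h
      rw [eToENN_neg_elog, if_pos (not_lt.1 h)] at hy
      exact lt_irrefl _ hy
    refine hnot ⟨hpos, hf.log.aestronglyMeasurable, ?_⟩
    have hbound : ∫⁻ y, ‖Real.log (f y)‖ₑ ∂μ ≤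
        ∫⁻ y, (eToENN (-elog (f y)) + ENNReal.ofReal (Real.log c)) ∂μ := by
      refine lintegral_mono_ae ?_
      filter_upwards [hpos, hfc] with y hy hyc
      rw [eToENN_neg_elog, if_neg hy.not_ge, Real.enorm_eq_ofReal_abs]
      rcases le_total 0 (Real.log (f y)) with h | h
      · rw [abs_of_nonneg h]
        exact (ENNReal.ofReal_le_ofReal (Real.log_le_log hy hyc)).trans le_add_self
      · rw [abs_of_nonpos h]
        exact le_self_add
    refine hbound.trans_lt ?_
    rw [lintegral_add_left hmeas, lintegral_const]
    exact ENNReal.add_lt_top.2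
      ⟨lt_top_iff_ne_top.2 hne, ENNReal.mul_lt_top ENNReal.ofReal_lt_top (measure_lt_top μ univ)⟩
  rw [eintE, htop, EReal.coe_ennreal_top, EReal.sub_top]

lemma min_max_div_pos {c₁ c₂ l lam : ℝ} (hc₂ : 0 < c₂) (hlam : 0 < lam) (hl : 0 < l) :
    0 < min c₂ (max c₁ (l / lam)) :=
  lt_min hc₂ (lt_max_of_lt_right (div_pos hl hlam))

/-- Variational inequality for clipping `l / lam` to `[c₁, c₂]`. -/
lemma div_clip_sub_mul_nonpos {c₁ c₂ l lam e : ℝ} (hc₂ : 0 < c₂) (hc : c₁ < c₂) (hlam : 0 < lam)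
    (hl : 0 < l) (he : e ∈ Icc c₁ c₂) :
    (l / min c₂ (max c₁ (l / lam)) - lam) * (e - min c₂ (max c₁ (l / lam))) ≤ 0 := by
  have hpos := min_max_div_pos (c₁ := c₁) hc₂ hlam hl
  rcases le_total c₂ (l / lam) with h | h
  · have hs : min c₂ (max c₁ (l / lam)) = c₂ := min_eq_left (h.trans (le_max_right _ _))
    rw [hs]
    refine mul_nonpos_of_nonneg_of_nonpos ?_ (sub_nonpos.2 he.2)
    rw [sub_nonneg, le_div_iff₀ hc₂, mul_comm]
    exact (le_div_iff₀ hlam).1 h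
  rcases le_total c₁ (l / lam) with h' | h'
  · have hs : min c₂ (max c₁ (l / lam)) = l / lam := by rw [max_eq_right h', min_eq_right h]
    rw [hs, div_div_cancel₀ hl.ne', sub_self, zero_mul]
  · have hs : min c₂ (max c₁ (l / lam)) = c₁ := by rw [max_eq_left h', min_eq_right hc.le]
    rw [hs] at hpos ⊢
    refine mul_nonpos_of_nonpos_of_nonneg ?_ (sub_nonneg.2 he.1)
    rw [sub_nonpos, div_le_iff₀ hpos, mul_comm]
    exact (div_le_iff₀ hlam).1 h'

lemma mul_log_lt_clip {c₁ c₂ l lam e : ℝ} (hc₂ : 0 < c₂) (hc : c₁ < c₂) (hlam : 0 < lam)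
    (hl : 0 < l) (he : e ∈ Icc c₁ c₂) (hepos : 0 < e) (hne : e ≠ min c₂ (max c₁ (l / lam))) :
    l * Real.log e < l * Real.log (min c₂ (max c₁ (l / lam))) +
      lam * (e - min c₂ (max c₁ (l / lam))) := by
  have hvar := div_clip_sub_mul_nonpos hc₂ hc hlam hl he
  have hpos := min_max_div_pos (c₁ := c₁) hc₂ hlam hl
  set s := min c₂ (max c₁ (l / lam))
  have hlog : Real.log e - Real.log s < e / s - 1 := by
    rw [← Real.log_div hepos.ne' hpos.ne']
    exact Real.log_lt_sub_one_of_pos (div_pos hepos hpos) fun h =>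
      hne ((div_eq_one_iff_eq hpos.ne').1 h)
  have hmul := mul_lt_mul_of_pos_left hlog hl
  have heq : l * (e / s - 1) = l / s * (e - s) := by field_simp
  linarith

lemma mul_log_le_clip {c₁ c₂ l lam e : ℝ} (hc₁ : 0 ≤ c₁) (hc : c₁ < c₂) (hlam : 0 < lam)
    (hl : 0 ≤ l) (he : e ∈ Icc c₁ c₂) (hepos : 0 < l → 0 < e) :
    l * Real.log e ≤ l * Real.log (min c₂ (max c₁ (l / lam))) +
      lam * (e - min c₂ (max c₁ (l / lam))) := by
  rcases hl.eq_or_lt with rfl | hl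
  · simpa [max_eq_left hc₁, min_eq_right hc.le] using mul_nonneg hlam.le (sub_nonneg.2 he.1)
  by_cases h : e = min c₂ (max c₁ (l / lam))
  · rw [← h, sub_self, mul_zero, add_zero]
  · exact (mul_log_lt_clip (hc₁.trans_lt hc) hc hlam hl he (hepos hl) h).le

lemma ae_rnDeriv_pos_imp {X : Type*} [MeasurableSpace X] {μ ν : Measure X} [IsFiniteMeasure μ]
    [IsFiniteMeasure ν] (hac : μ ≪ ν) {p : X → Prop} (h : ∀ᵐ x ∂μ, p x) :
    ∀ᵐ x ∂ν, 0 < (μ.rnDeriv ν x).toReal → p x := by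
  rw [← Measure.withDensity_rnDeriv_eq μ ν hac,
    ae_withDensity_iff (Measure.measurable_rnDeriv μ ν)] at h
  filter_upwards [h] with x hx hpos
  exact hx fun h0 => by simp [h0] at hpos

/-- The clipped, normalized likelihood ratio
`E* = min(c₂, max(c₁, L/λ*))` is the growth-rate optimal `[c₁, c₂]`-bounded e-variable for
`P₀` vs `P₁`, and (when `L > 0` a.s.) it is the `P₀`-a.s. unique maximizer. -/
theorem optimal_bounded_evariable
    {X : Type*} [MeasurableSpace X]
    (P₀ P₁ : Measure X) [IsProbabilityMeasure P₀] [IsProbabilityMeasure P₁]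
    (hac : P₁ ≪ P₀)
    (L : X → ℝ) (hLdef : L = fun x => (P₁.rnDeriv P₀ x).toReal)
    (c₁ c₂ : ℝ) (hc₁ : 0 ≤ c₁) (hc₁1 : c₁ ≤ 1) (h1c₂ : 1 ≤ c₂) (hc : c₁ < c₂)
    (lam : ℝ) (hlam : 0 < lam)
    (Estar : X → ℝ) (hEstar : Estar = fun x => min c₂ (max c₁ (L x / lam)))
    (hnorm : (∫ x, Estar x ∂P₀) = 1) :
    (∀ E : X → ℝ, Measurable E →
        (∀ᵐ x ∂P₀, E x ∈ Set.Icc c₁ c₂) → (∫ x, E x ∂P₀) ≤ 1 →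
        eintE P₁ (fun x => elog (E x)) ≤ eintE P₁ (fun x => elog (Estar x))) ∧
      ((∀ᵐ x ∂P₀, 0 < L x) →
        ∀ E : X → ℝ, Measurable E →
          (∀ᵐ x ∂P₀, E x ∈ Set.Icc c₁ c₂) → (∫ x, E x ∂P₀) ≤ 1 →
          eintE P₁ (fun x => elog (E x)) = eintE P₁ (fun x => elog (Estar x)) →
          E =ᵐ[P₀] Estar) := by
  have hc₂ : 0 < c₂ := hc₁.trans_lt hc
  have hLm : Measurable L := by
    rw [hLdef]
    exact (Measure.measurable_rnDeriv P₁ P₀).ennreal_toReal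
  have hLnn : ∀ x, 0 ≤ L x := fun x => by
    rw [hLdef]
    exact ENNReal.toReal_nonneg
  have hLint : Integrable L P₀ := by
    rw [hLdef]
    exact Measure.integrable_toReal_rnDeriv
  have hint_iff : ∀ f : X → ℝ, Integrable (fun x => L x * f x) P₀ ↔ Integrable f P₁ := fun f => by
    rw [hLdef]
    exact integrable_toReal_rnDeriv_mul_iff hac
  have hint_eq : ∀ f : X → ℝ, ∫ x, L x * f x ∂P₀ = ∫ x, f x ∂P₁ := fun f => by
    rw [hLdef]
    exact integral_toReal_rnDeriv_mul hac
  have hpos_imp : ∀ p : X → Prop, (∀ᵐ x ∂P₁, p x) → ∀ᵐ x ∂P₀, 0 < L x → p x := fun p hp => by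
    rw [hLdef]
    exact ae_rnDeriv_pos_imp hac hp
  have hLpos : ∀ᵐ x ∂P₁, 0 < L x := by
    rw [hLdef]
    filter_upwards [Measure.rnDeriv_pos hac, hac.ae_le (Measure.rnDeriv_lt_top P₁ P₀)] with x h0 h1
    exact ENNReal.toReal_pos h0.ne' h1.ne
  have hSx : ∀ x, Estar x = min c₂ (max c₁ (L x / lam)) := fun x => by rw [hEstar]
  have hSm : Measurable Estar := by
    rw [hEstar]
    exact measurable_const.min (measurable_const.max (hLm.div_const lam))
  have hSpos : ∀ x, 0 < L x → 0 < Estar x := fun x hx => by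
    rw [hSx]
    exact min_max_div_pos hc₂ hlam hx
  have hSmem : ∀ x, Estar x ∈ Icc c₁ c₂ := fun x => by
    rw [hSx]
    exact ⟨le_min hc.le (le_max_left _ _), min_le_left _ _⟩
  have hbdd_int : ∀ E : X → ℝ, Measurable E → (∀ᵐ x ∂P₀, E x ∈ Icc c₁ c₂) → Integrable E P₀ :=
    fun E hE hmem => Integrable.of_mem_Icc c₁ c₂ hE.aemeasurable hmem
  have hSint : Integrable Estar P₀ := hbdd_int Estar hSm (ae_of_all _ hSmem)
  have hSlog₀ : Integrable (fun x => L x * Real.log (Estar x)) P₀ := by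
    refine ((integrable_const lam).add (hLint.mul_const (Real.log c₂))).mono'
      (hLm.mul hSm.log).aestronglyMeasurable (ae_of_all _ fun x => ?_)
    have hlow := mul_log_le_clip hc₁ hc hlam (hLnn x) ⟨hc₁1, h1c₂⟩ fun _ => one_pos
    rw [← hSx, Real.log_one, mul_zero] at hlow
    have hSlam := mul_nonneg hlam.le (hc₁.trans (hSmem x).1)
    have hupp : L x * Real.log (Estar x) ≤ L x * Real.log c₂ := by
      rcases (hLnn x).eq_or_lt with h | h
      · simp [← h]
      · exact mul_le_mul_of_nonneg_left (Real.log_le_log (hSpos x h) (hSmem x).2) h.le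
    have hc₂log := mul_nonneg (hLnn x) (Real.log_nonneg h1c₂)
    simp only [Pi.add_apply, Real.norm_eq_abs]
    rw [abs_le]
    constructor <;> linarith
  have hSval := eintE_elog_of_integrable (hLpos.mono hSpos) ((hint_iff _).1 hSlog₀)
  have hgap : ∀ E : X → ℝ, (∀ᵐ x ∂P₀, E x ∈ Icc c₁ c₂) → (∀ᵐ x ∂P₁, 0 < E x) →
      ∀ᵐ x ∂P₀, 0 ≤ L x * Real.log (Estar x) + lam * (E x - Estar x) - L x * Real.log (E x) := by
    intro E hmem hE
    filter_upwards [hmem, hpos_imp _ hE] with x hx hxpos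
    rw [sub_nonneg, hSx]
    exact mul_log_le_clip hc₁ hc hlam (hLnn x) hx hxpos
  have hgap_int : ∀ E : X → ℝ, Measurable E → (∀ᵐ x ∂P₀, E x ∈ Icc c₁ c₂) →
      Integrable (fun x => Real.log (E x)) P₁ →
      Integrable (fun x => L x * Real.log (Estar x) + lam * (E x - Estar x) - L x * Real.log (E x))
        P₀ ∧
      ∫ x, (L x * Real.log (Estar x) + lam * (E x - Estar x) - L x * Real.log (E x)) ∂P₀ =
        ∫ x, Real.log (Estar x) ∂P₁ + lam * (∫ x, E x ∂P₀ - 1) - ∫ x, Real.log (E x) ∂P₁ := by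
    intro E hE hmem hlog
    have h₁ : Integrable (fun x => lam * (E x - Estar x)) P₀ :=
      ((hbdd_int E hE hmem).sub hSint).const_mul lam
    have h₂ := (hint_iff _).2 hlog
    refine ⟨(hSlog₀.add h₁).sub h₂, ?_⟩
    rw [integral_sub (by exact hSlog₀.add h₁) h₂, integral_add hSlog₀ h₁, integral_const_mul,
      integral_sub (hbdd_int E hE hmem) hSint, hnorm, hint_eq, hint_eq]
  refine ⟨fun E hE hmem hle => ?_, fun hL E hE hmem hle heq => ?_⟩
  · have hmem₁ : ∀ᵐ x ∂P₁, E x ∈ Icc c₁ c₂ := hac.ae_le hmem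
    by_cases hfin : (∀ᵐ x ∂P₁, 0 < E x) ∧ Integrable (fun x => Real.log (E x)) P₁
    · rw [eintE_elog_of_integrable hfin.1 hfin.2, hSval, EReal.coe_le_coe_iff]
      have h := integral_nonneg_of_ae (hgap E hmem hfin.1)
      rw [(hgap_int E hE hmem hfin.2).2] at h
      have := mul_nonpos_of_nonneg_of_nonpos hlam.le (sub_nonpos.2 hle)
      linarith
    · rw [eintE_elog_eq_bot hE (hmem₁.mono fun x hx => hx.2) hfin]
      exact bot_le
  · have hmem₁ : ∀ᵐ x ∂P₁, E x ∈ Icc c₁ c₂ := hac.ae_le hmem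
    by_cases hfin : (∀ᵐ x ∂P₁, 0 < E x) ∧ Integrable (fun x => Real.log (E x)) P₁
    · rw [eintE_elog_of_integrable hfin.1 hfin.2, hSval, EReal.coe_eq_coe_iff] at heq
      have hnn := hgap E hmem hfin.1
      obtain ⟨hi, hv⟩ := hgap_int E hE hmem hfin.2
      have hz := (integral_eq_zero_iff_of_nonneg_ae hnn hi).1 <| by
        refine le_antisymm ?_ (integral_nonneg_of_ae hnn)
        have := mul_nonpos_of_nonneg_of_nonpos hlam.le (sub_nonpos.2 hle)
        rw [hv]
        linarith
      filter_upwards [hz, hL, hmem, hpos_imp _ hfin.1] with x hx hLx hxm hxpos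
      by_contra hne
      rw [hSx] at hne
      have hlt := mul_log_lt_clip hc₂ hc hlam hLx hxm (hxpos hLx) hne
      rw [← hSx] at hlt
      simp only [Pi.zero_apply] at hx
      linarith
    · rw [eintE_elog_eq_bot hE (hmem₁.mono fun x hx => hx.2) hfin, hSval] at heq
      exact absurd heq.symm (EReal.coe_ne_bot _)
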